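/- Let M ∈ ℝ, let V : ℝ × ℝ³ → ℝ be continuous, let z ∈ ℂ, and let ψ : ℝ × ℝ³ → ℂ⁴ be of class C¹, compactly supported in space (there exists R > 0 with ψ(t,x) = 0 whenever |x| ≥ R), and satisfy −i γ⁰ ∂_t ψ − i ∑_{j=1}^{3} γ^j ∂_{x_j} ψ + M ψ = V ψ pointwise. If the Majorana condition ψ(0,x) + z γ² ψ*(0,x) = 0 holds for all x ∈ ℝ³, then ψ(t,x) + z γ² ψ*(t,x) = 0 for all (t,x) ∈ ℝ × ℝ³; that is, the Majorana condition is conserved under the evolution. -/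

import Mathlib

open Matrix Complex

noncomputable section

/-- The Dirac gamma matrix `γ⁰` in the Dirac representation. -/
def γ0 : Matrix (Fin 4) (Fin 4) ℂ :=
  !![1, 0, 0, 0; 0, 1, 0, 0; 0, 0, -1, 0; 0, 0, 0, -1]

/-- The Dirac gamma matrix `γ¹` in the Dirac representation. -/
def γ1 : Matrix (Fin 4) (Fin 4) ℂ :=
  !![0, 0, 0, 1; 0, 0, 1, 0; 0, -1, 0, 0; -1, 0, 0, 0]

/-- The Dirac gamma matrix `γ²` in the Dirac representation. -/
def γ2 : Matrix (Fin 4) (Fin 4) ℂ :=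
  !![0, 0, 0, -I; 0, 0, I, 0; 0, I, 0, 0; -I, 0, 0, 0]

/-- The Dirac gamma matrix `γ³` in the Dirac representation. -/
def γ3 : Matrix (Fin 4) (Fin 4) ℂ :=
  !![0, 0, 1, 0; 0, 0, 0, -1; -1, 0, 0, 0; 0, 1, 0, 0]

/-- All four gamma matrices `γ⁰, γ¹, γ², γ³`. -/
def γmat : Fin 4 → Matrix (Fin 4) (Fin 4) ℂ := ![γ0, γ1, γ2, γ3]

/-- The three spatial gamma matrices `γ¹, γ², γ³`. -/
def γsp : Fin 3 → Matrix (Fin 4) (Fin 4) ℂ := ![γ1, γ2, γ3]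

/-- Spacetime `ℝ × ℝ³`. -/
abbrev Spacetime := ℝ × EuclideanSpace ℝ (Fin 3)

/-- The Dirac operator applied to a spinor field `ψ` at a point `p`:
`−i γ⁰ ∂_t ψ − i ∑_{j=1}^{3} γ^j ∂_{x_j} ψ + M ψ` at `p`. -/
def diracOp (M : ℝ) (ψ : Spacetime → Fin 4 → ℂ) (p : Spacetime) : Fin 4 → ℂ :=
  -(Complex.I • (γ0 *ᵥ fderiv ℝ ψ p (1, 0)))
    - Complex.I • ∑ j : Fin 3, γsp j *ᵥ fderiv ℝ ψ p (0, EuclideanSpace.single j 1)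
    + (M : ℂ) • ψ p

open MeasureTheory Topology

/-- If a function on `ℝ × E` vanishes outside `‖x‖ < R`, so do its derivatives, outside `‖x‖ ≤ R`. -/
theorem fderiv_eq_zero_of_lt_norm {E : Type*} [NormedAddCommGroup E] [NormedSpace ℝ E]
    {F : Type*} [NormedAddCommGroup F] [NormedSpace ℝ F]
    {f : ℝ × E → F} {R : ℝ} (hf : ∀ t x, R ≤ ‖x‖ → f (t, x) = 0) {p : ℝ × E}
    (hp : R < ‖p.2‖) : fderiv ℝ f p = 0 := by
  have : f =ᶠ[𝓝 p] fun _ => 0 := by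
    filter_upwards [(isOpen_lt continuous_const continuous_snd.norm).mem_nhds hp] with q hq
    exact hf q.1 q.2 (le_of_lt hq)
  rw [this.fderiv_eq]
  simp

section ConservationLaw

variable {E : Type*} [NormedAddCommGroup E] [NormedSpace ℝ E] [FiniteDimensional ℝ E]
  [MeasurableSpace E] [BorelSpace E] (μ : Measure E) [μ.IsAddHaarMeasure]

/-- The integral of a directional derivative of a compactly supported `C¹` function vanishes. -/
theorem integral_fderiv_apply_eq_zero_of_hasCompactSupport {g : E → ℝ} (hg : ContDiff ℝ 1 g)
    (hs : HasCompactSupport g) (v : E) : ∫ x, fderiv ℝ g x v ∂μ = 0 := by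
  have hc : Continuous fun x => fderiv ℝ g x v :=
    (hg.continuous_fderiv one_ne_zero).clm_apply continuous_const
  have hi : Integrable (fun x => fderiv ℝ g x v) μ :=
    hc.integrable_of_hasCompactSupport (hs.fderiv_apply ℝ v)
  have := integral_mul_fderiv_eq_neg_fderiv_mul_of_integrable (μ := μ) (f := fun _ : E => (1 : ℝ))
    (g := g) (v := v) (by simp) (by simpa using hi)
    (by simpa using hg.continuous.integrable_of_hasCompactSupport hs)
    (fun x _ => differentiableAt_const _) (fun x _ => hg.differentiable one_ne_zero x)
  simpa using this

/-- Differentiation under the integral sign for a `C¹` function with uniformly bounded spatial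
support. -/
theorem hasDerivAt_integral_of_contDiff {ρ : ℝ × E → ℝ} (hρ : ContDiff ℝ 1 ρ) {R : ℝ}
    (hs : ∀ t x, R ≤ ‖x‖ → ρ (t, x) = 0) (t : ℝ) :
    HasDerivAt (fun s => ∫ x, ρ (s, x) ∂μ) (∫ x, fderiv ℝ ρ (t, x) (1, 0) ∂μ) t := by
  have hc : Continuous fun p => fderiv ℝ ρ p (1, 0) :=
    (hρ.continuous_fderiv one_ne_zero).clm_apply continuous_const
  have hK : IsCompact (Metric.closedBall t 1 ×ˢ Metric.closedBall (0 : E) R) :=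
    (isCompact_closedBall _ _).prod (isCompact_closedBall _ _)
  obtain ⟨C, hC⟩ := hK.exists_bound_of_continuousOn hc.continuousOn
  refine (hasDerivAt_integral_of_dominated_loc_of_deriv_le (F := fun s x => ρ (s, x))
    (F' := fun s x => fderiv ℝ ρ (s, x) (1, 0))
    (bound := (Metric.closedBall (0 : E) R).indicator fun _ => C)
    (Metric.closedBall_mem_nhds t one_pos) ?_ ?_ ?_ ?_ ?_ ?_).2
  · exact .of_forall fun s => (hρ.continuous.comp (by fun_prop)).aestronglyMeasurable
  · refine (hρ.continuous.comp (by fun_prop)).integrable_of_hasCompactSupport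
      (HasCompactSupport.intro (isCompact_closedBall (0 : E) R) fun x hx => hs t x ?_)
    simpa using (not_le.1 (mt mem_closedBall_zero_iff.2 hx)).le
  · exact (hc.comp (by fun_prop : Continuous fun x : E => (t, x))).aestronglyMeasurable
  · refine .of_forall fun x s hs' => ?_
    by_cases hx : x ∈ Metric.closedBall (0 : E) R
    · rw [Set.indicator_of_mem hx]
      exact hC (s, x) ⟨hs', hx⟩
    · rw [Set.indicator_of_notMem hx, fderiv_eq_zero_of_lt_norm hs]
      · simp
      · simpa using hx
  · exact (integrable_indicator_iff measurableSet_closedBall).2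
      (integrableOn_const (isCompact_closedBall _ _).measure_lt_top.ne)
  · refine .of_forall fun x s _ => ?_
    have h1 : HasDerivAt (fun r : ℝ => (r, x)) ((1 : ℝ), (0 : E)) s :=
      (hasDerivAt_id s).prodMk (hasDerivAt_const s x)
    exact (hρ.differentiable one_ne_zero (s, x)).hasFDerivAt.comp_hasDerivAt s h1

/-- A density satisfying a continuity equation with uniformly bounded spatial support has
conserved integral. -/
theorem integral_eq_of_continuity_equation {ι : Type*} [Fintype ι] {ρ : ℝ × E → ℝ}
    {J : ι → ℝ × E → ℝ} (e : ι → E) (hρ : ContDiff ℝ 1 ρ) (hJ : ∀ j, ContDiff ℝ 1 (J j)) {R : ℝ}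
    (hρs : ∀ t x, R ≤ ‖x‖ → ρ (t, x) = 0) (hJs : ∀ j t x, R ≤ ‖x‖ → J j (t, x) = 0)
    (h : ∀ p, fderiv ℝ ρ p (1, 0) + ∑ j, fderiv ℝ (J j) p (0, e j) = 0) (s t : ℝ) :
    ∫ x, ρ (s, x) ∂μ = ∫ x, ρ (t, x) ∂μ := by
  have key (r : ℝ) : ∫ x, fderiv ℝ ρ (r, x) (1, 0) ∂μ = 0 := by
    have hsupp (j) : HasCompactSupport fun x => J j (r, x) :=
      HasCompactSupport.intro (isCompact_closedBall (0 : E) R) fun x hx =>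
        hJs j r x (by simpa using (not_le.1 (mt mem_closedBall_zero_iff.2 hx)).le)
    have hcd (j) : ContDiff ℝ 1 fun x => J j (r, x) := (hJ j).comp (by fun_prop)
    have hfd (j) (x : E) : fderiv ℝ (J j) (r, x) (0, e j) =
        fderiv ℝ (fun y => J j (r, y)) x (e j) := by
      have h1 : HasFDerivAt (fun y : E => (r, y)) (ContinuousLinearMap.inr ℝ ℝ E) x :=
        hasFDerivAt_prodMk_right r x
      have h2 : fderiv ℝ (fun y => J j (r, y)) x = _ :=
        (((hJ j).differentiable one_ne_zero (r, x)).hasFDerivAt.comp x h1).fderiv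
      simp [h2]
    have hrw (x : E) : fderiv ℝ ρ (r, x) (1, 0) =
        -∑ j, fderiv ℝ (fun y => J j (r, y)) x (e j) := by
      rw [eq_neg_iff_add_eq_zero, ← h (r, x)]
      simp only [hfd]
    simp only [hrw]
    rw [integral_neg, integral_finsetSum]
    · simp [integral_fderiv_apply_eq_zero_of_hasCompactSupport μ (hcd _) (hsupp _)]
    · intro j _
      exact (((hcd j).continuous_fderiv one_ne_zero).clm_apply
        continuous_const).integrable_of_hasCompactSupport ((hsupp j).fderiv_apply ℝ (e j))
  have hd (r : ℝ) := hasDerivAt_integral_of_contDiff μ hρ hρs r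
  exact is_const_of_deriv_eq_zero (fun r => (hd r).differentiableAt)
    (fun r => (hd r).deriv.trans (key r)) s t

end ConservationLaw

/-- The real bilinear form `(v, w) ↦ Re (v† A w)`. -/
def reSesq {n : Type*} [Fintype n] (A : Matrix n n ℂ) : (n → ℂ) →L[ℝ] (n → ℂ) →L[ℝ] ℝ :=
  (LinearMap.mk₂ ℝ (fun v w : n → ℂ => (star v ⬝ᵥ A *ᵥ w).re)
    (fun v v' w => by simp [add_dotProduct])
    (fun c v w => by simp [smul_dotProduct])
    (fun v w w' => by simp [mulVec_add])
    (fun c v w => by simp [mulVec_smul])).toContinuousBilinearMap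

theorem reSesq_apply {n : Type*} [Fintype n] (A : Matrix n n ℂ) (v w : n → ℂ) :
    reSesq A v w = (star v ⬝ᵥ A *ᵥ w).re := rfl

theorem reSesq_comm {n : Type*} [Fintype n] {A : Matrix n n ℂ} (hA : A.IsHermitian)
    (v w : n → ℂ) : reSesq A v w = reSesq A w v := by
  have h : star (star v ⬝ᵥ A *ᵥ w) = star w ⬝ᵥ A *ᵥ v := by
    rw [star_dotProduct, star_mulVec, hA.eq, star_star, dotProduct_mulVec]
  rw [reSesq_apply, reSesq_apply, ← h]
  simp

theorem fderiv_reSesq_self {n : Type*} [Fintype n] {A : Matrix n n ℂ} (hA : A.IsHermitian)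
    {X : Type*} [NormedAddCommGroup X] [NormedSpace ℝ X] {φ : X → n → ℂ} {p : X}
    (hφ : DifferentiableAt ℝ φ p) (v : X) :
    fderiv ℝ (fun q => reSesq A (φ q) (φ q)) p v = 2 * reSesq A (φ p) (fderiv ℝ φ p v) := by
  rw [((reSesq A).hasFDerivAt_of_bilinear hφ.hasFDerivAt hφ.hasFDerivAt).fderiv]
  simp [reSesq_comm hA (fderiv ℝ φ p v) (φ p), two_mul]

/-- The real linear map `v ↦ v + z γ² v*`, whose kernel is the Majorana condition. -/
def majoranaMap (z : ℂ) : (Fin 4 → ℂ) →L[ℝ] (Fin 4 → ℂ) :=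
  LinearMap.toContinuousLinearMap
    { toFun := fun v => v + z • (γ2 *ᵥ star v)
      map_add' := fun v w => by
        rw [star_add, mulVec_add, smul_add]
        abel
      map_smul' := fun c v => by
        rw [star_smul, mulVec_smul, smul_comm z, smul_add]
        simp }

theorem majoranaMap_apply (z : ℂ) (v : Fin 4 → ℂ) :
    majoranaMap z v = v + z • (γ2 *ᵥ star v) := rfl

/-- The Majorana map preserves solutions of the Dirac equation with real scalar potential. -/
theorem diracOp_majoranaMap {M W : ℝ} (z : ℂ) {ψ : Spacetime → Fin 4 → ℂ} {p : Spacetime}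
    (hψ : DifferentiableAt ℝ ψ p) (h : diracOp M ψ p = (W : ℂ) • ψ p) :
    diracOp M (fun q => majoranaMap z (ψ q)) p = (W : ℂ) • majoranaMap z (ψ p) := by
  have hd (v) : fderiv ℝ (fun q => majoranaMap z (ψ q)) p v = majoranaMap z (fderiv ℝ ψ p v) := by
    have h1 : fderiv ℝ (fun q => majoranaMap z (ψ q)) p = _ :=
      ((majoranaMap z).hasFDerivAt.comp p hψ.hasFDerivAt).fderiv
    rw [h1]
    rfl
  simp only [diracOp, hd, Fin.sum_univ_three] at h ⊢
  generalize fderiv ℝ ψ p (1, 0) = a at *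
  generalize fderiv ℝ ψ p (0, EuclideanSpace.single 0 1) = b at *
  generalize fderiv ℝ ψ p (0, EuclideanSpace.single 1 1) = c at *
  generalize fderiv ℝ ψ p (0, EuclideanSpace.single 2 1) = d at *
  have e0 := congrFun h 0
  have e1 := congrFun h 1
  have e2 := congrFun h 2
  have e3 := congrFun h 3
  have f0 := congrArg star e0
  have f1 := congrArg star e1
  have f2 := congrArg star e2
  have f3 := congrArg star e3
  simp [γ0, γsp, γ1, γ3, γ2, dotProduct, Fin.sum_univ_four] at e0 e1 e2 e3 f0 f1 f2 f3
  ext k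
  fin_cases k <;>
    simp [majoranaMap_apply, γ0, γsp, γ1, γ2, γ3, dotProduct, Fin.sum_univ_four,
      vecHead, vecTail]
  · linear_combination e0 - z * I * f3
  · linear_combination e1 + z * I * f2
  · linear_combination e2 + z * I * f1
  · linear_combination e3 - z * I * f0

theorem isHermitian_γ0_mul_γsp (j : Fin 3) : (γ0 * γsp j).IsHermitian := by
  fin_cases j <;> ext k l <;> fin_cases k <;> fin_cases l <;>
    simp [γ0, γsp, γ1, γ2, γ3, Matrix.mul_apply, Fin.sum_univ_four]

/-- The continuity equation for the Dirac current, with real scalar potential. -/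
theorem continuity_equation_of_diracOp {M W : ℝ} {φ : Spacetime → Fin 4 → ℂ} {p : Spacetime}
    (h : diracOp M φ p = (W : ℂ) • φ p) :
    reSesq 1 (φ p) (fderiv ℝ φ p (1, 0)) + ∑ j, reSesq (γ0 * γsp j) (φ p)
      (fderiv ℝ φ p (0, EuclideanSpace.single j 1)) = 0 := by
  simp only [diracOp, Fin.sum_univ_three] at h ⊢
  generalize fderiv ℝ φ p (1, 0) = a at *
  generalize fderiv ℝ φ p (0, EuclideanSpace.single 0 1) = b at *
  generalize fderiv ℝ φ p (0, EuclideanSpace.single 1 1) = c at *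
  generalize fderiv ℝ φ p (0, EuclideanSpace.single 2 1) = d at *
  have key := congrArg (fun v => (star (φ p) ⬝ᵥ γ0 *ᵥ v).im) h
  simp [reSesq_apply, γ0, γsp, γ1, γ2, γ3, mulVec, dotProduct, Fin.sum_univ_four]
    at key ⊢
  linear_combination -key

/-- if `ψ` is `C¹`, compactly supported in space, solves the
Dirac equation with a continuous real scalar potential `V`, and satisfies the
Majorana condition `ψ(0,·) + z γ² ψ*(0,·) = 0`, then the Majorana condition
holds for all times. -/
theorem majorana_condition_conserved (M : ℝ) (V : Spacetime → ℝ)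
    (hV : Continuous V) (z : ℂ) (ψ : Spacetime → Fin 4 → ℂ)
    (hψ : ContDiff ℝ 1 ψ)
    (hsupp : ∃ R > 0, ∀ (t : ℝ) (x : EuclideanSpace ℝ (Fin 3)),
      R ≤ ‖x‖ → ψ (t, x) = 0)
    (heq : ∀ p, diracOp M ψ p = (V p : ℂ) • ψ p)
    (h0 : ∀ x : EuclideanSpace ℝ (Fin 3),
      ψ (0, x) + z • (γ2 *ᵥ star (ψ (0, x))) = 0) :
    ∀ (t : ℝ) (x : EuclideanSpace ℝ (Fin 3)),
      ψ (t, x) + z • (γ2 *ᵥ star (ψ (t, x))) = 0 := by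
  obtain ⟨R, -, hR⟩ := hsupp
  set φ : Spacetime → Fin 4 → ℂ := fun p => majoranaMap z (ψ p) with hφ_def
  have hφ : ContDiff ℝ 1 φ := (majoranaMap z).contDiff.comp hψ
  have hφs (t x) (hx : R ≤ ‖x‖) : φ (t, x) = 0 := by
    simp only [hφ_def, hR t x hx, map_zero]
  have hφ0 (x) : φ (0, x) = 0 := h0 x
  have hJ (A : Matrix (Fin 4) (Fin 4) ℂ) : ContDiff ℝ 1 fun q => reSesq A (φ q) (φ q) :=
    ((reSesq A).contDiff.comp hφ).clm_apply hφ
  have hJs (A : Matrix (Fin 4) (Fin 4) ℂ) (t x) (hx : R ≤ ‖x‖) :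
      reSesq A (φ (t, x)) (φ (t, x)) = 0 := by simp [hφs t x hx]
  have hcons (p) : fderiv ℝ (fun q => reSesq 1 (φ q) (φ q)) p (1, 0) + ∑ j,
      fderiv ℝ (fun q => reSesq (γ0 * γsp j) (φ q) (φ q)) p (0, EuclideanSpace.single j 1) = 0 := by
    have hd := hφ.differentiable one_ne_zero p
    simp only [fderiv_reSesq_self isHermitian_one hd,
      fderiv_reSesq_self (isHermitian_γ0_mul_γsp _) hd]
    rw [← Finset.mul_sum, ← mul_add, continuity_equation_of_diracOp
      (diracOp_majoranaMap z (hψ.differentiable one_ne_zero p) (heq p)), mul_zero]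
  intro t x
  have hint : ∫ y, reSesq 1 (φ (t, y)) (φ (t, y)) = 0 := by
    rw [integral_eq_of_continuity_equation volume _ (hJ 1) (fun j => hJ (γ0 * γsp j)) (hJs 1)
      (fun j => hJs _) hcons t 0]
    simp [hφ0]
  have hnn (v : Fin 4 → ℂ) : reSesq 1 v v = ∑ k, Complex.normSq (v k) := by
    simp [reSesq_apply, dotProduct, Complex.normSq_apply]
  have hc : Continuous fun y => reSesq 1 (φ (t, y)) (φ (t, y)) :=
    (hJ 1).continuous.comp (by fun_prop : Continuous fun y => (t, y))
  have hcs : HasCompactSupport fun y => reSesq 1 (φ (t, y)) (φ (t, y)) :=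
    HasCompactSupport.intro (isCompact_closedBall (0 : EuclideanSpace ℝ (Fin 3)) R) fun y hy =>
      hJs 1 t y (by simpa using (not_le.1 (mt mem_closedBall_zero_iff.2 hy)).le)
  have hzero : reSesq 1 (φ (t, x)) (φ (t, x)) = 0 := by
    by_contra hne
    refine (hc.integral_pos_of_hasCompactSupport_nonneg_nonzero (μ := volume) hcs
      (fun y => ?_) hne).ne' hint
    simp only [hnn, Pi.zero_apply]
    exact Finset.sum_nonneg fun k _ => Complex.normSq_nonneg _
  rw [hnn, Finset.sum_eq_zero_iff_of_nonneg fun k _ => Complex.normSq_nonneg _] at hzero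
  exact funext fun k => Complex.normSq_eq_zero.1 (hzero k (Finset.mem_univ k))
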